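/- For every μ ∈ ℝ, the map x ↦ Φ⁻¹(F_μ(x)) is differentiable on ℝ and its derivative satisfies ∂Φ⁻¹(F_μ(x))/∂x < 1/(σρ) for all x ∈ ℝ; equivalently, f_μ(x) < φ(Φ⁻¹(F_μ(x)))/(σρ) for all x ∈ ℝ. -/

import Mathlib

open MeasureTheory ProbabilityTheory Set Filter Topology

noncomputable def stdphi (x : ℝ) : ℝ := Real.exp (-(x ^ 2) / 2) / Real.sqrt (2 * Real.pi)

noncomputable def stdPhi (x : ℝ) : ℝ := ∫ t in Iic x, stdphi t

noncomputable def stdPhiInv : ℝ → ℝ := Function.invFun stdPhi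

noncomputable def stdPhiE (c : EReal) (x s : ℝ) : ℝ :=
  if c = ⊤ then 1 else if c = ⊥ then 0 else stdPhi ((c.toReal - x) / s)

def truncOrdered {k : ℕ} (a b : Fin k → EReal) : Prop :=
  (∀ i, a i < b i) ∧ ∀ i j : Fin k, i < j → b i < a j

def truncSet {k : ℕ} (a b : Fin k → EReal) : Set ℝ :=
  {x : ℝ | ∃ i, a i < (x : EReal) ∧ (x : EReal) < b i}

noncomputable def truncSum {k : ℕ} (a b : Fin k → EReal) (s x : ℝ) : ℝ :=
  ∑ i, (stdPhiE (b i) x s - stdPhiE (a i) x s)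

noncomputable def condPDF {k : ℕ} (a b : Fin k → EReal) (σ τ μ x : ℝ) : ℝ :=
  (1 / σ) * stdphi ((x - μ) / σ) * truncSum a b τ x
    / truncSum a b (Real.sqrt (σ ^ 2 + τ ^ 2)) μ

noncomputable def Fmu {k : ℕ} (a b : Fin k → EReal) (σ τ μ x : ℝ) : ℝ :=
  ∫ u in Iic x, condPDF a b σ τ μ u

/-- `G_μ(x,v) = Φ((x - (ρ²μ + (1-ρ²)v))/(σρ))` with `ρ² = τ²/(σ²+τ²)`. -/
noncomputable def Gfun (σ τ μ x v : ℝ) : ℝ :=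
  stdPhi ((x - (τ ^ 2 / (σ ^ 2 + τ ^ 2) * μ + (1 - τ ^ 2 / (σ ^ 2 + τ ^ 2)) * v)) /
    (σ * Real.sqrt (τ ^ 2 / (σ ^ 2 + τ ^ 2))))

/-- `G_μ(x,v)` for an extended-real `v`, with the natural conventions at `±∞`. -/
noncomputable def GfunE (σ τ μ x : ℝ) (c : EReal) : ℝ :=
  if c = ⊤ then 0 else if c = ⊥ then 1 else Gfun σ τ μ x c.toReal

/-- `h(v)` from Lemma `le_dmu_formula`. -/
noncomputable def hfun {k : ℕ} (a b : Fin k → EReal) (σ τ μ v : ℝ) : ℝ :=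
  (1 / Real.sqrt (σ ^ 2 + τ ^ 2)) * stdphi ((v - μ) / Real.sqrt (σ ^ 2 + τ ^ 2)) /
    truncSum a b (Real.sqrt (σ ^ 2 + τ ^ 2)) μ

/-- `h(v)` for an extended-real `v`, with the convention `φ(±∞) = 0`. -/
noncomputable def hfunE {k : ℕ} (a b : Fin k → EReal) (σ τ μ : ℝ) (c : EReal) : ℝ :=
  if c = ⊤ then 0 else if c = ⊥ then 0 else hfun a b σ τ μ c.toReal

/-- `l(x,v)` from Lemma `le_dens_dx`. -/
noncomputable def lfun {k : ℕ} (a b : Fin k → EReal) (τ x v : ℝ) : ℝ :=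
  (1 / τ) * stdphi ((v - x) / τ) / truncSum a b τ x

/-- `l(x,v)` for an extended-real `v`, with the convention `φ(±∞) = 0`. -/
noncomputable def lfunE {k : ℕ} (a b : Fin k → EReal) (τ x : ℝ) (c : EReal) : ℝ :=
  if c = ⊤ then 0 else if c = ⊥ then 0 else lfun a b τ x c.toReal

/-- The function `B_μ(x)` from the proof of Proposition 1. -/
noncomputable def Bfun {k : ℕ} (a b : Fin k → EReal) (σ τ μ x : ℝ) : ℝ :=
  Real.sqrt (τ ^ 2 / (σ ^ 2 + τ ^ 2)) / σ * stdphi (stdPhiInv (Fmu a b σ τ μ x))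
    - condPDF a b σ τ μ x
    + ∑ i, (hfunE a b σ τ μ (b i) * (Fmu a b σ τ μ x - GfunE σ τ μ x (b i))
        - hfunE a b σ τ μ (a i) * (Fmu a b σ τ μ x - GfunE σ τ μ x (a i)))

theorem stdphi_pos (x : ℝ) : 0 < stdphi x := by
  unfold stdphi; positivity

theorem stdphi_eq_gaussianPDFReal : stdphi = gaussianPDFReal 0 1 := by
  ext x
  simp [stdphi, gaussianPDFReal]
  ring

theorem continuous_stdphi : Continuous stdphi := by
  unfold stdphi; fun_prop

theorem integrable_stdphi : Integrable stdphi := by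
  rw [stdphi_eq_gaussianPDFReal]; exact integrable_gaussianPDFReal 0 1

theorem integral_stdphi : ∫ t, stdphi t = 1 := by
  rw [stdphi_eq_gaussianPDFReal]; exact integral_gaussianPDFReal_eq_one 0 one_ne_zero

theorem hasDerivAt_stdphi (x : ℝ) : HasDerivAt stdphi (-x * stdphi x) x := by
  have h : HasDerivAt (fun y : ℝ => -(y ^ 2) / 2) (-x) x :=
    (((hasDerivAt_pow 2 x).neg).div_const 2).congr_deriv (by simp; ring)
  exact ((h.exp).div_const (Real.sqrt (2 * Real.pi))).congr_deriv (by unfold stdphi; ring)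

theorem hasDerivAt_integral_Iic {f : ℝ → ℝ} (hc : Continuous f) (hi : Integrable f) (x : ℝ) :
    HasDerivAt (fun y => ∫ t in Iic y, f t) (f x) x := by
  have h : (fun y => ∫ t in Iic y, f t) = fun y => (∫ t in (0 : ℝ)..y, f t) + ∫ t in Iic 0, f t := by
    ext y
    rw [← intervalIntegral.integral_Iic_sub_Iic hi.integrableOn hi.integrableOn]
    ring
  rw [h]
  exact (intervalIntegral.integral_hasDerivAt_right (hc.intervalIntegrable _ _)
    (hc.stronglyMeasurableAtFilter _ _) hc.continuousAt).add_const _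

theorem hasDerivAt_stdPhi (x : ℝ) : HasDerivAt stdPhi (stdphi x) x :=
  hasDerivAt_integral_Iic continuous_stdphi integrable_stdphi x

theorem continuous_stdPhi : Continuous stdPhi :=
  continuous_iff_continuousAt.2 fun x => (hasDerivAt_stdPhi x).continuousAt

theorem strictMono_stdPhi : StrictMono stdPhi :=
  strictMono_of_hasDerivAt_pos hasDerivAt_stdPhi stdphi_pos

theorem tendsto_stdPhi_atBot : Tendsto stdPhi atBot (𝓝 0) := by
  have h := tendsto_setIntegral_of_antitone (μ := volume) (f := stdphi)
    (s := fun x : ℝᵒᵈ => Iic (OrderDual.ofDual x)) (fun _ => measurableSet_Iic)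
    (fun x y hxy => Iic_subset_Iic.2 hxy) ⟨OrderDual.toDual 0, integrable_stdphi.integrableOn⟩
  have he : ⋂ x : ℝᵒᵈ, Iic (OrderDual.ofDual x) = (∅ : Set ℝ) := by
    ext y
    simp only [mem_iInter, mem_Iic, mem_empty_iff_false, iff_false, not_forall, not_le]
    exact ⟨OrderDual.toDual (y - 1), by simp⟩
  rw [he] at h
  rw [setIntegral_empty] at h
  exact h

theorem tendsto_stdPhi_atTop : Tendsto stdPhi atTop (𝓝 1) := by
  have h := tendsto_setIntegral_of_monotone (μ := volume) (f := stdphi)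
    (s := fun x : ℝ => Iic x) (fun _ => measurableSet_Iic)
    (fun x y hxy => Iic_subset_Iic.2 hxy) integrable_stdphi.integrableOn
  rw [iUnion_Iic, setIntegral_univ, integral_stdphi] at h
  exact h

theorem stdPhi_pos (x : ℝ) : 0 < stdPhi x :=
  lt_of_le_of_lt (strictMono_stdPhi.monotone.le_of_tendsto tendsto_stdPhi_atBot (x - 1))
    (strictMono_stdPhi (by linarith))

theorem stdPhi_lt_one (x : ℝ) : stdPhi x < 1 :=
  lt_of_lt_of_le (strictMono_stdPhi (by linarith))
    (strictMono_stdPhi.monotone.ge_of_tendsto tendsto_stdPhi_atTop (x + 1))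

theorem stdPhi_stdPhiInv {p : ℝ} (h0 : 0 < p) (h1 : p < 1) : stdPhi (stdPhiInv p) = p := by
  apply Function.invFun_eq
  obtain ⟨y, hy⟩ := (tendsto_stdPhi_atBot.eventually_lt_const h0).exists
  obtain ⟨z, hz⟩ := (tendsto_stdPhi_atTop.eventually_const_lt h1).exists
  exact mem_range_of_exists_le_of_exists_ge continuous_stdPhi ⟨y, hy.le⟩ ⟨z, hz.le⟩

theorem hasDerivAt_stdPhiInv {p : ℝ} (h0 : 0 < p) (h1 : p < 1) :
    HasDerivAt stdPhiInv (stdphi (stdPhiInv p))⁻¹ p := by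
  have hs : HasStrictDerivAt stdPhi (stdphi (stdPhiInv p)) (stdPhiInv p) :=
    hasStrictDerivAt_of_hasDerivAt_of_continuousAt (.of_forall hasDerivAt_stdPhi)
      continuous_stdphi.continuousAt
  have := hs.to_local_left_inverse (stdphi_pos _).ne' (g := stdPhiInv)
    (.of_forall (Function.leftInverse_invFun strictMono_stdPhi.injective))
  rw [stdPhi_stdPhiInv h0 h1] at this
  exact this.hasDerivAt

/-- Strict concavity of `φ ∘ Φ⁻¹`, as the tangent line inequality at `Φ z₀`. -/
theorem stdphi_lt_tangent {z z₀ : ℝ} (h : z ≠ z₀) :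
    stdphi z < stdphi z₀ - z₀ * (stdPhi z - stdPhi z₀) := by
  have hd (y : ℝ) : HasDerivAt (fun y => stdphi y + z₀ * stdPhi y) ((z₀ - y) * stdphi y) y :=
    ((hasDerivAt_stdphi y).add ((hasDerivAt_stdPhi y).const_mul z₀)).congr_deriv (by ring)
  have hc : Continuous fun y => stdphi y + z₀ * stdPhi y :=
    continuous_stdphi.add (continuous_const.mul continuous_stdPhi)
  have key : stdphi z + z₀ * stdPhi z < stdphi z₀ + z₀ * stdPhi z₀ := by
    rcases lt_or_gt_of_ne h with h | h
    · refine strictMonoOn_of_hasDerivWithinAt_pos (convex_Iic z₀) hc.continuousOn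
        (fun y _ => (hd y).hasDerivWithinAt) (fun y hy => ?_) h.le self_mem_Iic h
      rw [interior_Iic] at hy
      exact mul_pos (sub_pos.2 hy) (stdphi_pos y)
    · refine strictAntiOn_of_hasDerivWithinAt_neg (convex_Ici z₀) hc.continuousOn
        (fun y _ => (hd y).hasDerivWithinAt) (fun y hy => ?_) self_mem_Ici h.le h
      rw [interior_Ici] at hy
      exact mul_neg_of_neg_of_pos (sub_neg.2 hy) (stdphi_pos y)
  linarith

/-- The density of the normal distribution with mean `m` and standard deviation `s`. -/
noncomputable def normalDensity (m s v : ℝ) : ℝ := (1 / s) * stdphi ((v - m) / s)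

theorem normalDensity_pos (m : ℝ) {s : ℝ} (hs : 0 < s) (v : ℝ) : 0 < normalDensity m s v :=
  mul_pos (by positivity) (stdphi_pos _)

theorem continuous_normalDensity (m s : ℝ) : Continuous (normalDensity m s) := by
  have := continuous_stdphi
  unfold normalDensity; fun_prop

theorem integrable_normalDensity (m : ℝ) {s : ℝ} (hs : 0 < s) :
    Integrable (normalDensity m s) :=
  ((integrable_stdphi.comp_div hs.ne').comp_sub_right m).const_mul _

theorem integral_normalDensity (m : ℝ) {s : ℝ} (hs : 0 < s) : ∫ v, normalDensity m s v = 1 := by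
  simp only [normalDensity]
  rw [integral_const_mul, integral_sub_right_eq_self (fun v => stdphi (v / s)),
    Measure.integral_comp_div, integral_stdphi, abs_of_pos hs]
  simp [hs.ne']

theorem setIntegral_Iic_normalDensity (m : ℝ) {s : ℝ} (hs : 0 < s) (c : ℝ) :
    ∫ v in Iic c, normalDensity m s v = stdPhi ((c - m) / s) := by
  have hd (v : ℝ) : HasDerivAt (fun v => stdPhi ((v - m) / s)) (normalDensity m s v) v := by
    have := (hasDerivAt_stdPhi ((v - m) / s)).comp v (((hasDerivAt_id v).sub_const m).div_const s)
    rwa [mul_comm] at this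
  have hl : Tendsto (fun v => stdPhi ((v - m) / s)) atBot (𝓝 0) :=
    tendsto_stdPhi_atBot.comp ((tendsto_atBot_add_const_right _ (-m) tendsto_id).atBot_div_const hs)
  rw [integral_Iic_of_hasDerivAt_of_tendsto' (fun v _ => hd v)
    (integrable_normalDensity m hs).integrableOn hl, sub_zero]

theorem normalDensity_mul_normalDensity {σ τ ρ : ℝ} (hσ : 0 < σ) (hτ : 0 < τ) (hρ : 0 < ρ)
    (hρ2 : ρ ^ 2 = τ ^ 2 / (σ ^ 2 + τ ^ 2)) (μ x v : ℝ) :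
    normalDensity μ σ x * normalDensity x τ v =
      normalDensity μ (Real.sqrt (σ ^ 2 + τ ^ 2)) v *
        normalDensity (ρ ^ 2 * μ + (1 - ρ ^ 2) * v) (σ * ρ) x := by
  have hS : 0 < σ ^ 2 + τ ^ 2 := by positivity
  set s := Real.sqrt (σ ^ 2 + τ ^ 2) with hs
  have hs0 : 0 < s := Real.sqrt_pos.2 hS
  have hs2 : s ^ 2 = σ ^ 2 + τ ^ 2 := Real.sq_sqrt hS.le
  have hρe : ρ = τ / s := by
    rw [← hs2, ← div_pow] at hρ2
    exact (pow_left_inj₀ hρ.le (by positivity) two_ne_zero).1 hρ2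
  have he : Real.exp (-(((x - μ) / σ) ^ 2) / 2) * Real.exp (-(((v - x) / τ) ^ 2) / 2) =
      Real.exp (-(((v - μ) / s) ^ 2) / 2) *
        Real.exp (-(((x - (ρ ^ 2 * μ + (1 - ρ ^ 2) * v)) / (σ * ρ)) ^ 2) / 2) := by
    rw [← Real.exp_add, ← Real.exp_add]
    congr 1
    simp only [div_pow, mul_pow, hs2, hρ2]
    field_simp
    ring
  have hc : 1 / σ * (1 / τ) = 1 / s * (1 / (σ * ρ)) := by
    rw [hρe]; field_simp
  simp only [normalDensity, stdphi]
  linear_combination (1 / σ * (1 / τ)) / (Real.sqrt (2 * Real.pi)) ^ 2 * he +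
    Real.exp (-(((v - μ) / s) ^ 2) / 2) *
        Real.exp (-(((x - (ρ ^ 2 * μ + (1 - ρ ^ 2) * v)) / (σ * ρ)) ^ 2) / 2) /
          (Real.sqrt (2 * Real.pi)) ^ 2 * hc

theorem measurableSet_coe_le (c : EReal) : MeasurableSet {v : ℝ | (v : EReal) ≤ c} :=
  measurable_coe_real_ereal measurableSet_Iic

theorem stdPhiE_eq_setIntegral (c : EReal) (x : ℝ) {s : ℝ} (hs : 0 < s) :
    stdPhiE c x s = ∫ v in {v : ℝ | (v : EReal) ≤ c}, normalDensity x s v := by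
  induction c with
  | bot => simp [stdPhiE]
  | top => simp [stdPhiE, integral_normalDensity x hs]
  | coe c =>
    have : {v : ℝ | (v : EReal) ≤ c} = Iic c := by ext; simp
    rw [this, setIntegral_Iic_normalDensity x hs]
    simp [stdPhiE]

theorem stdPhiE_sub_eq_setIntegral {c d : EReal} (h : c < d) (x : ℝ) {s : ℝ} (hs : 0 < s) :
    stdPhiE d x s - stdPhiE c x s =
      ∫ v in {v : ℝ | c < v ∧ (v : EReal) ≤ d}, normalDensity x s v := by
  have he : {v : ℝ | c < v ∧ (v : EReal) ≤ d} =
      {v : ℝ | (v : EReal) ≤ d} \ {v : ℝ | (v : EReal) ≤ c} := by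
    ext v
    simp [and_comm]
  have hsub : {v : ℝ | (v : EReal) ≤ c} ⊆ {v : ℝ | (v : EReal) ≤ d} := fun v hv => le_trans hv h.le
  rw [he, setIntegral_sdiff (measurableSet_coe_le c) (integrable_normalDensity x hs).integrableOn
    hsub, stdPhiE_eq_setIntegral d x hs, stdPhiE_eq_setIntegral c x hs]

/-- Lebesgue measure on the union of the intervals with endpoints `a i` and `b i`. -/
noncomputable def truncMeasure {k : ℕ} (a b : Fin k → EReal) : Measure ℝ :=
  ∑ i, volume.restrict {v : ℝ | a i < v ∧ (v : EReal) ≤ b i}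

instance {k : ℕ} (a b : Fin k → EReal) : SFinite (truncMeasure a b) := by
  unfold truncMeasure
  rw [← Measure.sum_fintype]
  infer_instance

theorem MeasureTheory.Integrable.truncMeasure {k : ℕ} (a b : Fin k → EReal) {f : ℝ → ℝ}
    (hf : Integrable f) : Integrable f (truncMeasure a b) :=
  integrable_finsetSum_measure.2 fun _ _ => hf.restrict

theorem truncSum_eq_integral {k : ℕ} {a b : Fin k → EReal} (hab : ∀ i, a i < b i) {s : ℝ}
    (hs : 0 < s) (x : ℝ) : truncSum a b s x = ∫ v, normalDensity x s v ∂truncMeasure a b := by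
  unfold truncMeasure
  rw [integral_finsetSum_measure fun i _ => (integrable_normalDensity x hs).restrict]
  exact Finset.sum_congr rfl fun i _ => stdPhiE_sub_eq_setIntegral (hab i) x hs

theorem truncMeasure_singleton {k : ℕ} (a b : Fin k → EReal) (v : ℝ) :
    truncMeasure a b {v} = 0 := by
  simp [truncMeasure, Measure.finsetSum_apply]

theorem truncMeasure_univ_pos {k : ℕ} {a b : Fin (k + 1) → EReal} (hab : ∀ i, a i < b i) :
    0 < truncMeasure a b univ := by
  obtain ⟨r, hr1, hr2⟩ := EReal.lt_iff_exists_real_btwn.1 (hab 0)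
  have ho : IsOpen {v : ℝ | a 0 < v ∧ (v : EReal) < b 0} :=
    isOpen_Ioo.preimage continuous_coe_real_ereal
  have hp : 0 < volume {v : ℝ | a 0 < v ∧ (v : EReal) ≤ b 0} :=
    (ho.measure_pos volume ⟨r, hr1, hr2⟩).trans_le (measure_mono fun v hv => ⟨hv.1, hv.2.le⟩)
  simp only [truncMeasure, Measure.finsetSum_apply, Measure.restrict_apply_univ]
  exact hp.trans_le (Finset.single_le_sum
    (f := fun i => volume {v : ℝ | a i < v ∧ (v : EReal) ≤ b i}) (fun _ _ => zero_le)
    (Finset.mem_univ 0))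

theorem integral_truncMeasure_pos {k : ℕ} {a b : Fin (k + 1) → EReal} (hab : ∀ i, a i < b i)
    {f : ℝ → ℝ} (hi : Integrable f (truncMeasure a b)) (h0 : ∀ v, 0 ≤ f v) (v₀ : ℝ)
    (hf : ∀ v, v ≠ v₀ → 0 < f v) : 0 < ∫ v, f v ∂truncMeasure a b := by
  rw [integral_pos_iff_support_of_nonneg h0 hi]
  refine (truncMeasure_univ_pos hab).trans_le ?_
  rw [← measure_sdiff_null (truncMeasure_singleton a b v₀)]
  exact measure_mono fun v hv => (hf v hv.2).ne'

theorem truncSum_pos {k : ℕ} {a b : Fin (k + 1) → EReal} (hab : ∀ i, a i < b i) {s : ℝ}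
    (hs : 0 < s) (x : ℝ) : 0 < truncSum a b s x := by
  rw [truncSum_eq_integral hab hs]
  exact integral_truncMeasure_pos hab ((integrable_normalDensity x hs).truncMeasure a b)
    (fun v => (normalDensity_pos x hs v).le) 0 (fun v _ => normalDensity_pos x hs v)

theorem stdPhiE_mem_Icc (c : EReal) (x s : ℝ) : stdPhiE c x s ∈ Icc (0 : ℝ) 1 := by
  unfold stdPhiE
  split_ifs
  · simp
  · simp
  · exact ⟨(stdPhi_pos _).le, (stdPhi_lt_one _).le⟩

theorem truncSum_le {k : ℕ} (a b : Fin k → EReal) (s x : ℝ) : truncSum a b s x ≤ k := by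
  have : truncSum a b s x ≤ ∑ _i : Fin k, (1 : ℝ) :=
    Finset.sum_le_sum fun i _ => by
      linarith [(stdPhiE_mem_Icc (b i) x s).2, (stdPhiE_mem_Icc (a i) x s).1]
  simpa using this

theorem continuous_truncSum {k : ℕ} (a b : Fin k → EReal) (s : ℝ) :
    Continuous (truncSum a b s) := by
  have h (c : EReal) : Continuous fun x => stdPhiE c x s := by
    have := continuous_stdPhi
    unfold stdPhiE
    split_ifs <;> fun_prop
  exact continuous_finsetSum _ fun i _ => (h _).sub (h _)

theorem continuous_condPDF {k : ℕ} (a b : Fin k → EReal) (σ τ μ : ℝ) :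
    Continuous (condPDF a b σ τ μ) :=
  ((continuous_normalDensity μ σ).mul (continuous_truncSum a b τ)).div_const _

theorem integrable_normalDensity_mul_truncSum {k : ℕ} {a b : Fin (k + 1) → EReal}
    (hab : ∀ i, a i < b i) {σ τ : ℝ} (hσ : 0 < σ) (hτ : 0 < τ) (μ : ℝ) :
    Integrable fun x => normalDensity μ σ x * truncSum a b τ x := by
  refine (integrable_normalDensity μ hσ).mul_bdd (c := ((k + 1 : ℕ) : ℝ))
    (continuous_truncSum a b τ).aestronglyMeasurable (.of_forall fun x => ?_)
  rw [Real.norm_of_nonneg (truncSum_pos hab hτ x).le]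
  exact truncSum_le a b τ x

theorem integrable_condPDF {k : ℕ} {a b : Fin (k + 1) → EReal}
    (hab : ∀ i, a i < b i) {σ τ : ℝ} (hσ : 0 < σ) (hτ : 0 < τ) (μ : ℝ) :
    Integrable (condPDF a b σ τ μ) :=
  (integrable_normalDensity_mul_truncSum hab hσ hτ μ).div_const _

theorem hasDerivAt_Fmu {k : ℕ} {a b : Fin (k + 1) → EReal}
    (hab : ∀ i, a i < b i) {σ τ : ℝ} (hσ : 0 < σ) (hτ : 0 < τ) (μ x : ℝ) :
    HasDerivAt (Fmu a b σ τ μ) (condPDF a b σ τ μ x) x :=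
  hasDerivAt_integral_Iic (continuous_condPDF a b σ τ μ) (integrable_condPDF hab hσ hτ μ) x

theorem integrable_joint {k : ℕ} {a b : Fin (k + 1) → EReal}
    (hab : ∀ i, a i < b i) {σ τ : ℝ} (hσ : 0 < σ) (hτ : 0 < τ) (μ : ℝ) :
    Integrable (Function.uncurry fun x v => normalDensity μ σ x * normalDensity x τ v)
      (volume.prod (truncMeasure a b)) := by
  have hc : Continuous (Function.uncurry fun x v => normalDensity μ σ x * normalDensity x τ v) := by
    have := continuous_stdphi
    unfold normalDensity Function.uncurry
    fun_prop
  refine (integrable_prod_iff hc.aestronglyMeasurable).2 ⟨.of_forall fun x =>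
    ((integrable_normalDensity x hτ).truncMeasure a b).const_mul
      (normalDensity μ σ x), ?_⟩
  refine (integrable_normalDensity_mul_truncSum hab hσ hτ μ).congr (.of_forall fun x => ?_)
  have h (v : ℝ) : ‖normalDensity μ σ x * normalDensity x τ v‖ =
      normalDensity μ σ x * normalDensity x τ v :=
    Real.norm_of_nonneg (mul_pos (normalDensity_pos μ hσ x) (normalDensity_pos x hτ v)).le
  simp only [Function.uncurry, h, integral_const_mul, truncSum_eq_integral hab hτ]

section Mixture

variable {k : ℕ} {a b : Fin (k + 1) → EReal} {σ τ ρ : ℝ}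

/-- The conditional density is a mixture of normal densities of standard deviation `σρ`. -/
theorem condPDF_eq_integral (hab : ∀ i, a i < b i) (hσ : 0 < σ) (hτ : 0 < τ) (hρ : 0 < ρ)
    (hρ2 : ρ ^ 2 = τ ^ 2 / (σ ^ 2 + τ ^ 2)) (μ x : ℝ) :
    condPDF a b σ τ μ x = (∫ v, normalDensity μ (Real.sqrt (σ ^ 2 + τ ^ 2)) v *
      normalDensity (ρ ^ 2 * μ + (1 - ρ ^ 2) * v) (σ * ρ) x ∂truncMeasure a b) /
        truncSum a b (Real.sqrt (σ ^ 2 + τ ^ 2)) μ := by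
  simp only [← normalDensity_mul_normalDensity hσ hτ hρ hρ2, integral_const_mul]
  rw [← truncSum_eq_integral hab hτ]
  rfl

theorem Fmu_eq_integral (hab : ∀ i, a i < b i) (hσ : 0 < σ) (hτ : 0 < τ) (hρ : 0 < ρ)
    (hρ2 : ρ ^ 2 = τ ^ 2 / (σ ^ 2 + τ ^ 2)) (μ x : ℝ) :
    Fmu a b σ τ μ x = (∫ v, normalDensity μ (Real.sqrt (σ ^ 2 + τ ^ 2)) v *
      stdPhi ((x - (ρ ^ 2 * μ + (1 - ρ ^ 2) * v)) / (σ * ρ)) ∂truncMeasure a b) /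
        truncSum a b (Real.sqrt (σ ^ 2 + τ ^ 2)) μ := by
  have hj := integrable_joint hab hσ hτ μ
  simp only [normalDensity_mul_normalDensity hσ hτ hρ hρ2] at hj
  simp only [Fmu, condPDF_eq_integral hab hσ hτ hρ hρ2, integral_div]
  rw [integral_integral_swap (hj.mono_measure (Measure.prod_mono Measure.restrict_le_self le_rfl))]
  simp only [integral_const_mul, setIntegral_Iic_normalDensity _ (mul_pos hσ hρ)]

theorem integrable_weight_mul (hσ : 0 < σ) (μ : ℝ) {g : ℝ → ℝ} (hg : Continuous g) {C : ℝ}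
    (hC : ∀ v, |g v| ≤ C) :
    Integrable (fun v => normalDensity μ (Real.sqrt (σ ^ 2 + τ ^ 2)) v * g v)
      (truncMeasure a b) :=
  ((integrable_normalDensity μ (Real.sqrt_pos.2 (by positivity))).truncMeasure a b).mul_bdd
    hg.aestronglyMeasurable (.of_forall hC)

end Mixture

theorem stdphi_le_one (x : ℝ) : stdphi x ≤ 1 := by
  unfold stdphi
  refine div_le_one_of_le₀ ?_ (Real.sqrt_nonneg _)
  calc Real.exp (-(x ^ 2) / 2) ≤ 1 := Real.exp_le_one_iff.2 (by nlinarith [sq_nonneg x])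
    _ ≤ Real.sqrt (2 * Real.pi) := Real.one_le_sqrt.2 (by linarith [Real.pi_gt_three])

theorem Fmu_mem_Ioo {k : ℕ} {a b : Fin (k + 1) → EReal} {σ τ ρ : ℝ} (hab : ∀ i, a i < b i)
    (hσ : 0 < σ) (hτ : 0 < τ) (hρ : 0 < ρ)
    (hρ2 : ρ ^ 2 = τ ^ 2 / (σ ^ 2 + τ ^ 2)) (μ x : ℝ) : Fmu a b σ τ μ x ∈ Ioo (0 : ℝ) 1 := by
  have hs : 0 < Real.sqrt (σ ^ 2 + τ ^ 2) := Real.sqrt_pos.2 (by positivity)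
  have hD := truncSum_pos hab hs μ
  have hc : Continuous fun v => stdPhi ((x - (ρ ^ 2 * μ + (1 - ρ ^ 2) * v)) / (σ * ρ)) :=
    continuous_stdPhi.comp (by fun_prop)
  have hi := integrable_weight_mul (a := a) (b := b) (τ := τ) hσ μ hc (C := 1) fun v => by
    rw [abs_of_pos (stdPhi_pos _)]; exact (stdPhi_lt_one _).le
  have hw := (integrable_normalDensity μ hs).truncMeasure a b
  rw [Fmu_eq_integral hab hσ hτ hρ hρ2]
  constructor
  · have hp (v : ℝ) := mul_pos (normalDensity_pos μ hs v)
      (stdPhi_pos ((x - (ρ ^ 2 * μ + (1 - ρ ^ 2) * v)) / (σ * ρ)))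
    exact div_pos (integral_truncMeasure_pos hab hi (fun v => (hp v).le) 0 fun v _ => hp v) hD
  · rw [div_lt_one hD, truncSum_eq_integral hab hs, ← sub_pos, ← integral_sub hw hi]
    have hp (v : ℝ) := sub_pos.2 (mul_lt_of_lt_one_right (normalDensity_pos μ hs v)
      (stdPhi_lt_one ((x - (ρ ^ 2 * μ + (1 - ρ ^ 2) * v)) / (σ * ρ))))
    exact integral_truncMeasure_pos hab (hw.sub hi) (fun v => (hp v).le) 0 fun v _ => hp v

theorem condPDF_lt {k : ℕ} {a b : Fin (k + 1) → EReal} {σ τ ρ : ℝ} (hab : ∀ i, a i < b i)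
    (hσ : 0 < σ) (hτ : 0 < τ) (hρ : 0 < ρ)
    (hρ2 : ρ ^ 2 = τ ^ 2 / (σ ^ 2 + τ ^ 2)) (μ x : ℝ) :
    condPDF a b σ τ μ x < stdphi (stdPhiInv (Fmu a b σ τ μ x)) / (σ * ρ) := by
  have hs : 0 < Real.sqrt (σ ^ 2 + τ ^ 2) := Real.sqrt_pos.2 (by positivity)
  have hD := truncSum_pos hab hs μ
  have hσρ : 0 < σ * ρ := mul_pos hσ hρ
  have hρ1 : 0 < 1 - ρ ^ 2 := by
    rw [hρ2, sub_pos, div_lt_one (by positivity)]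
    linarith [pow_pos hσ 2]
  set w := normalDensity μ (Real.sqrt (σ ^ 2 + τ ^ 2)) with hwdef
  set Z : ℝ → ℝ := fun v => (x - (ρ ^ 2 * μ + (1 - ρ ^ 2) * v)) / (σ * ρ) with hZ
  set D := truncSum a b (Real.sqrt (σ ^ 2 + τ ^ 2)) μ
  obtain ⟨hF0, hF1⟩ := Fmu_mem_Ioo hab hσ hτ hρ hρ2 μ x
  have hFz := stdPhi_stdPhiInv hF0 hF1
  set z₀ := stdPhiInv (Fmu a b σ τ μ x)
  have hZc : Continuous Z := by fun_prop
  have hiPhi : Integrable (fun v => w v * stdPhi (Z v)) (truncMeasure a b) :=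
    integrable_weight_mul hσ μ (continuous_stdPhi.comp hZc) (C := 1) fun v => by
      rw [abs_of_pos (stdPhi_pos _)]; exact (stdPhi_lt_one _).le
  have hiphi : Integrable (fun v => w v * stdphi (Z v)) (truncMeasure a b) :=
    integrable_weight_mul hσ μ (continuous_stdphi.comp hZc) (C := 1) fun v => by
      rw [abs_of_pos (stdphi_pos _)]; exact stdphi_le_one _
  have hiw : Integrable w (truncMeasure a b) := (integrable_normalDensity μ hs).truncMeasure a b
  have hDw : ∫ v, w v ∂truncMeasure a b = D := (truncSum_eq_integral hab hs μ).symm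
  have hFD : ∫ v, w v * stdPhi (Z v) ∂truncMeasure a b = stdPhi z₀ * D := by
    rw [hFz, Fmu_eq_integral hab hσ hτ hρ hρ2, div_mul_cancel₀ _ hD.ne']
  have hf : condPDF a b σ τ μ x =
      (∫ v, w v * stdphi (Z v) ∂truncMeasure a b) / (σ * ρ) / D := by
    rw [condPDF_eq_integral hab hσ hτ hρ hρ2, ← integral_div (σ * ρ)]
    congr 1
    refine integral_congr_ae (.of_forall fun v => ?_)
    simp only [hwdef, normalDensity, hZ]
    ring
  have hpos (v : ℝ) (hv : Z v ≠ z₀) :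
      0 < (stdphi z₀ + z₀ * stdPhi z₀) * w v - z₀ * (w v * stdPhi (Z v)) - w v * stdphi (Z v) := by
    have := mul_pos (normalDensity_pos μ hs v) (sub_pos.2 (stdphi_lt_tangent hv))
    rw [← hwdef] at this
    linarith
  have hnonneg (v : ℝ) :
      0 ≤ (stdphi z₀ + z₀ * stdPhi z₀) * w v - z₀ * (w v * stdPhi (Z v)) - w v * stdphi (Z v) := by
    by_cases hv : Z v = z₀
    · rw [hv]; apply le_of_eq; ring
    · exact (hpos v hv).le
  have hZne (v : ℝ) (hv : v ≠ (x - ρ ^ 2 * μ - z₀ * (σ * ρ)) / (1 - ρ ^ 2)) : Z v ≠ z₀ := by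
    rintro h
    apply hv
    rw [hZ, div_eq_iff hσρ.ne'] at h
    rw [eq_div_iff hρ1.ne']
    linarith
  have hi : Integrable (fun v => (stdphi z₀ + z₀ * stdPhi z₀) * w v - z₀ * (w v * stdPhi (Z v)))
      (truncMeasure a b) := (hiw.const_mul _).sub (hiPhi.const_mul _)
  have key : 0 < ∫ v, (stdphi z₀ + z₀ * stdPhi z₀) * w v - z₀ * (w v * stdPhi (Z v)) -
      w v * stdphi (Z v) ∂truncMeasure a b :=
    integral_truncMeasure_pos hab (hi.sub hiphi) hnonneg _ fun v hv => hpos v (hZne v hv)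
  rw [integral_sub hi hiphi,
    integral_sub (hiw.const_mul _) (hiPhi.const_mul _), integral_const_mul, integral_const_mul,
    hDw, hFD] at key
  rw [hf, div_right_comm]
  refine div_lt_div_of_pos_right ?_ hσρ
  rw [div_lt_iff₀ hD]
  linarith

/-- Lemma 1: for every `μ`, the map `x ↦ Φ⁻¹(F_μ(x))` is differentiable with derivative
everywhere `< 1/(σρ)`; equivalently `f_μ(x) < φ(Φ⁻¹(F_μ(x)))/(σρ)`. -/
theorem stmt9 {k : ℕ} (a b : Fin (k + 1) → EReal) (hab : truncOrdered a b)
    (σ τ ρ : ℝ) (hσ : 0 < σ) (hτ : 0 < τ)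
    (hρ : 0 < ρ) (hρ2 : ρ ^ 2 = τ ^ 2 / (σ ^ 2 + τ ^ 2)) (μ : ℝ) :
    (∀ x : ℝ, ∃ d : ℝ,
      HasDerivAt (fun y => stdPhiInv (Fmu a b σ τ μ y)) d x ∧ d < 1 / (σ * ρ)) ∧
    ∀ x : ℝ, condPDF a b σ τ μ x < stdphi (stdPhiInv (Fmu a b σ τ μ x)) / (σ * ρ) := by
  refine ⟨fun x => ⟨_, (hasDerivAt_stdPhiInv (Fmu_mem_Ioo hab.1 hσ hτ hρ hρ2 μ x).1
    (Fmu_mem_Ioo hab.1 hσ hτ hρ hρ2 μ x).2).comp x (hasDerivAt_Fmu hab.1 hσ hτ μ x), ?_⟩,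
    condPDF_lt hab.1 hσ hτ hρ hρ2 μ⟩
  have h := condPDF_lt hab.1 hσ hτ hρ hρ2 μ x
  have hp := stdphi_pos (stdPhiInv (Fmu a b σ τ μ x))
  rw [inv_mul_lt_iff₀ hp]
  rwa [mul_one_div]
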